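/- (Fefferman–Stein vector maximal inequality.) Let d ≥ 1 and 1 < p < ∞, 1 < q < ∞. There exists a constant C, depending only on d, p, q, such that for every sequence (f_j)_{j∈ℤ} of measurable functions on ℝ^d one has ‖ x ↦ (∑_{j∈ℤ} (Mf_j(x))^q)^{1/q} ‖_{L^p(ℝ^d)} ≤ C ‖ x ↦ (∑_{j∈ℤ} |f_j(x)|^q)^{1/q} ‖_{L^p(ℝ^d)}. -/

import Mathlib

/- STATEMENT 3: the Fefferman–Stein vector-valued maximal inequality. -/

open MeasureTheory Real
open scoped ENNReal NNReal

noncomputable section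

/-- The Hardy–Littlewood maximal function (with values in `ℝ≥0∞`). -/
def maxFn {d : ℕ} (f : EuclideanSpace ℝ (Fin d) → ℂ) (x : EuclideanSpace ℝ (Fin d)) : ℝ≥0∞ :=
  ⨆ r : {r : ℝ // 0 < r},
    (volume (Metric.ball x r.1))⁻¹ * ∫⁻ y in Metric.ball x r.1, (‖f y‖₊ : ℝ≥0∞)

section Maximal

open Metric Set Filter Topology

/-- The centered maximal function of `f : E → ℝ≥0∞` with respect to the measure `μ`. -/
def centeredMax {E : Type*} [PseudoMetricSpace E] [MeasurableSpace E] (μ : Measure E)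
    (f : E → ℝ≥0∞) (x : E) : ℝ≥0∞ :=
  ⨆ r : {r : ℝ // 0 < r}, (μ (ball x r.1))⁻¹ * ∫⁻ y in ball x r.1, f y ∂μ

section Besicovitch

variable {E : Type*} [MetricSpace E] [SecondCountableTopology E] [MeasurableSpace E]
  [OpensMeasurableSpace E]

lemma mul_measure_le_of_ballPackage {N : ℕ} {τ : ℝ} (hτ : 1 < τ)
    (hN : IsEmpty (Besicovitch.SatelliteConfig E N τ)) {ν κ : Measure E} {c : ℝ≥0∞} {A : Set E}
    {R : ℝ} (hA : ∀ x ∈ A, ∃ r, 0 < r ∧ r ≤ R ∧ c * ν (ball x r) ≤ κ (ball x r)) :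
    c * ν A ≤ N * κ univ := by
  choose! r hr0 hrR hr using hA
  let P : Besicovitch.BallPackage A E :=
    { c := fun x => x
      r := fun x => r x
      rpos := fun x => hr0 x x.2
      r_bound := R
      r_le := fun x => hrR x x.2 }
  obtain ⟨s, hs, hcov⟩ := Besicovitch.exist_disjoint_covering_families hτ hN P
  have hdisj : ∀ i, (s i).PairwiseDisjoint fun j => ball (P.c j) (P.r j) := fun i =>
    (hs i).mono fun j => ball_subset_closedBall
  have hcount : ∀ i, (s i).Countable := fun i =>
    (hdisj i).countable_of_isOpen (fun _ _ => isOpen_ball)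
      (fun j _ => nonempty_ball.2 (P.rpos j))
  have hAsub : A ⊆ ⋃ i : Fin N, ⋃ j ∈ s i, ball (P.c j) (P.r j) := by
    simpa [P] using hcov
  calc c * ν A ≤ c * ∑ i : Fin N, ν (⋃ j ∈ s i, ball (P.c j) (P.r j)) := by
        gcongr
        exact (measure_mono hAsub).trans (measure_iUnion_fintype_le _ _)
    _ = ∑ i : Fin N, c * ν (⋃ j ∈ s i, ball (P.c j) (P.r j)) := Finset.mul_sum _ _ _
    _ ≤ ∑ i : Fin N, κ univ := by
        gcongr with i
        rw [measure_biUnion (hcount i) (hdisj i) fun _ _ => measurableSet_ball,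
          ← ENNReal.tsum_mul_left]
        calc ∑' j : s i, c * ν (ball (P.c j) (P.r j))
            ≤ ∑' j : s i, κ (ball (P.c j) (P.r j)) :=
              ENNReal.tsum_le_tsum fun j => hr _ j.1.2
          _ = κ (⋃ j ∈ s i, ball (P.c j) (P.r j)) :=
              (measure_biUnion (hcount i) (hdisj i) fun _ _ => measurableSet_ball).symm
          _ ≤ κ univ := measure_mono (subset_univ _)
    _ = N * κ univ := by simp

variable (E) in
/-- Comparison of two measures through a covering by balls, without any bound on the radii. -/
lemma exists_besicovitch_const [HasBesicovitchCovering E] : ∃ N : ℕ, ∀ (ν κ : Measure E)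
    (c : ℝ≥0∞) (A : Set E), (∀ x ∈ A, ∃ r, 0 < r ∧ c * ν (ball x r) ≤ κ (ball x r)) →
      c * ν A ≤ N * κ univ := by
  obtain ⟨N, τ, hτ, hN⟩ := HasBesicovitchCovering.no_satelliteConfig (α := E)
  refine ⟨N, fun ν κ c A hA => ?_⟩
  let S : ℕ → Set E := fun n => {x ∈ A | ∃ r : ℝ, 0 < r ∧ r ≤ n ∧ c * ν (ball x r) ≤ κ (ball x r)}
  have hS : Monotone S := fun m n hmn x ⟨hx, r, h0, hr, h⟩ =>
    ⟨hx, r, h0, hr.trans (by exact_mod_cast hmn), h⟩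
  have hAS : A = ⋃ n, S n := by
    refine Subset.antisymm (fun x hx => ?_) (iUnion_subset fun n => sep_subset _ _)
    obtain ⟨r, h0, h⟩ := hA x hx
    obtain ⟨n, hn⟩ := exists_nat_ge r
    exact mem_iUnion.2 ⟨n, hx, r, h0, hn, h⟩
  rw [hAS, hS.measure_iUnion, ENNReal.mul_iSup]
  exact iSup_le fun n => mul_measure_le_of_ballPackage hτ hN fun x hx => hx.2

variable (E) in
/-- Weak type `(1, 1)` bound for the centered maximal function of an arbitrary measure. -/
lemma exists_weakType_centeredMax [HasBesicovitchCovering E] : ∃ N : ℕ, ∀ (μ : Measure E)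
    (f : E → ℝ≥0∞), Measurable f → ∀ c : ℝ≥0∞,
      c * μ {x | c < centeredMax μ f x} ≤ N * ∫⁻ x, f x ∂μ := by
  obtain ⟨N, hN⟩ := exists_besicovitch_const E
  refine ⟨N, fun μ f _ c => ?_⟩
  have := hN μ (μ.withDensity f) c {x | c < centeredMax μ f x} fun x hx => by
    rw [mem_ofPred_eq, centeredMax, lt_iSup_iff] at hx
    obtain ⟨⟨r, hr⟩, h⟩ := hx
    refine ⟨r, hr, ?_⟩
    rw [withDensity_apply _ measurableSet_ball]
    refine ENNReal.mul_le_of_le_div ?_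
    rw [ENNReal.div_eq_inv_mul]
    exact h.le
  simpa using this

end Besicovitch

lemma lintegral_Ioi_rpow_mul_indicator {s : ℝ} (hs : 0 < s) {a : ℝ≥0∞} (ha : a ≠ ∞) :
    ∫⁻ t in Ioi (0 : ℝ), ENNReal.ofReal (t ^ (s - 1)) *
      ({t : ℝ | ENNReal.ofReal t < a}.indicator 1 t) = ENNReal.ofReal s⁻¹ * a ^ s := by
  lift a to ℝ≥0 using ha
  have hset : {t : ℝ | ENNReal.ofReal t < a} ∩ Ioi 0 = Ioo 0 (a : ℝ) := by
    ext t
    simp only [mem_inter_iff, mem_ofPred_eq, mem_Ioi, mem_Ioo]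
    constructor
    · rintro ⟨h, h0⟩
      exact ⟨h0, by rwa [← ENNReal.ofReal_coe_nnreal, ENNReal.ofReal_lt_ofReal_iff_of_nonneg h0.le] at h⟩
    · rintro ⟨h0, h⟩
      exact ⟨by rwa [← ENNReal.ofReal_coe_nnreal, ENNReal.ofReal_lt_ofReal_iff_of_nonneg h0.le], h0⟩
  have hmeas : MeasurableSet {t : ℝ | ENNReal.ofReal t < a} :=
    measurableSet_lt ENNReal.measurable_ofReal measurable_const
  have : ∀ t : ℝ, ENNReal.ofReal (t ^ (s - 1)) *
      ({t : ℝ | ENNReal.ofReal t < a}.indicator 1 t) =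
      {t : ℝ | ENNReal.ofReal t < a}.indicator (fun t => ENNReal.ofReal (t ^ (s - 1))) t := by
    intro t
    by_cases h : t ∈ {t : ℝ | ENNReal.ofReal t < a} <;> simp [h]
  simp_rw [this]
  rw [lintegral_indicator hmeas, Measure.restrict_restrict hmeas, hset]
  have hint : IntervalIntegrable (fun t : ℝ => t ^ (s - 1)) volume 0 a :=
    intervalIntegral.intervalIntegrable_rpow' (by linarith)
  rw [← ofReal_integral_eq_lintegral_ofReal, ← integral_Ioc_eq_integral_Ioo,
    ← intervalIntegral.integral_of_le a.coe_nonneg, integral_rpow (Or.inl (by linarith))]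
  · rw [← ENNReal.ofReal_coe_nnreal, ENNReal.ofReal_rpow_of_nonneg a.coe_nonneg hs.le,
      ← ENNReal.ofReal_mul (by positivity)]
    congr 1
    simp [Real.zero_rpow hs.ne']
    ring
  · exact ((intervalIntegrable_iff_integrableOn_Ioc_of_le a.2).1 hint).mono_set Ioo_subset_Ioc_self
  · filter_upwards [ae_restrict_mem measurableSet_Ioo] with t ht
    exact Real.rpow_nonneg ht.1.le _

lemma lintegral_Ioi_rpow_mul_indicator_le {s : ℝ} (hs : 0 < s) (a : ℝ≥0∞) :
    ∫⁻ t in Ioi (0 : ℝ), ENNReal.ofReal (t ^ (s - 1)) *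
      ({t : ℝ | ENNReal.ofReal t < a}.indicator 1 t) ≤ ENNReal.ofReal s⁻¹ * a ^ s := by
  rcases eq_or_ne a ∞ with rfl | ha
  · rw [ENNReal.top_rpow_of_pos hs, ENNReal.mul_top (by simpa using hs)]
    exact le_top
  · exact (lintegral_Ioi_rpow_mul_indicator hs ha).le

lemma le_lintegral_Ioi_rpow_mul_indicator {s : ℝ} (hs : 0 < s) (a : ℝ≥0∞) :
    a ^ s ≤ ENNReal.ofReal s * ∫⁻ t in Ioi (0 : ℝ), ENNReal.ofReal (t ^ (s - 1)) *
      ({t : ℝ | ENNReal.ofReal t < a}.indicator 1 t) := by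
  have hfin : ∀ b : ℝ≥0∞, b ≠ ∞ → b ≤ a → b ^ s ≤ ENNReal.ofReal s *
      ∫⁻ t in Ioi (0 : ℝ), ENNReal.ofReal (t ^ (s - 1)) *
        ({t : ℝ | ENNReal.ofReal t < a}.indicator 1 t) := by
    intro b hb hba
    calc b ^ s = ENNReal.ofReal s * (ENNReal.ofReal s⁻¹ * b ^ s) := by
          rw [← mul_assoc, ← ENNReal.ofReal_mul hs.le, mul_inv_cancel₀ hs.ne']
          simp
      _ ≤ _ := by
          rw [← lintegral_Ioi_rpow_mul_indicator hs hb]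
          gcongr
  rcases eq_or_ne a ∞ with rfl | ha
  · rw [ENNReal.top_rpow_of_pos hs]
    refine ENNReal.le_of_forall_nnreal_lt fun r _ => ?_
    have := hfin ((r : ℝ≥0∞) ^ s⁻¹) (by simp [hs.le]) le_top
    rwa [ENNReal.rpow_inv_rpow hs.ne'] at this
  · exact hfin a ha le_rfl

lemma centeredMax_le_add {E : Type*} [PseudoMetricSpace E] [MeasurableSpace E]
    (μ : Measure E) (f : E → ℝ≥0∞) (c : ℝ≥0∞) (x : E) :
    centeredMax μ f x ≤ centeredMax μ ({y | c < f y}.indicator f) x + c := by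
  refine iSup_le fun r => ?_
  calc (μ (ball x r.1))⁻¹ * ∫⁻ y in ball x r.1, f y ∂μ
      ≤ (μ (ball x r.1))⁻¹ * ∫⁻ y in ball x r.1, ({y | c < f y}.indicator f y + c) ∂μ := by
        gcongr with y
        by_cases h : c < f y
        · simp [h]
        · simpa [h] using not_lt.1 h
    _ = (μ (ball x r.1))⁻¹ * ∫⁻ y in ball x r.1, ({y | c < f y}.indicator f y) ∂μ
        + (μ (ball x r.1))⁻¹ * μ (ball x r.1) * c := by
        rw [lintegral_add_right _ measurable_const, lintegral_const, mul_add]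
        simp only [MeasurableSet.univ, Measure.restrict_apply, univ_inter]
        ring
    _ ≤ _ := by
        gcongr
        · exact le_iSup (fun r : {r : ℝ // 0 < r} => (μ (ball x r.1))⁻¹ *
            ∫⁻ y in ball x r.1, ({y | c < f y}.indicator f y) ∂μ) r
        · exact mul_le_of_le_one_left zero_le (ENNReal.inv_mul_le_one _)

/-- Marcinkiewicz interpolation for the centered maximal function, from a (two-measure) weak type
`(1, 1)` bound and the trivial `L^∞` bound. -/
lemma lintegral_centeredMax_rpow_le {E : Type*} [PseudoMetricSpace E] [MeasurableSpace E]
    [OpensMeasurableSpace E] {μ ν κ : Measure E} [SFinite ν] [SFinite κ] {K : ℝ≥0∞}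
    (hweak : ∀ f : E → ℝ≥0∞, Measurable f → ∀ c : ℝ≥0∞,
      c * ν {x | c < centeredMax μ f x} ≤ K * ∫⁻ x, f x ∂κ)
    {q : ℝ} (hq : 1 < q) {f : E → ℝ≥0∞} (hf : Measurable f) :
    ∫⁻ x, centeredMax μ f x ^ q ∂ν ≤
      2 ^ q * ENNReal.ofReal q * K * ENNReal.ofReal (q - 1)⁻¹ * ∫⁻ x, f x ^ q ∂κ := by
  have hq0 : 0 < q := by linarith
  obtain ⟨G, hG, hGle, hGeq⟩ := exists_measurable_le_lintegral_eq ν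
    (fun x => centeredMax μ f x ^ q)
  set g : E → ℝ≥0∞ := fun x => G x ^ q⁻¹ / 2 with hg
  have hgm : Measurable g := (hG.pow_const _).div_const _
  have hgle : ∀ x, g x ≤ centeredMax μ f x / 2 := fun x => by
    simp only [hg]
    gcongr
    rw [ENNReal.rpow_inv_le_iff hq0]
    exact hGle x
  have hGg : ∀ x, G x = 2 ^ q * g x ^ q := fun x => by
    rw [← ENNReal.mul_rpow_of_nonneg _ _ hq0.le, hg,
      ENNReal.mul_div_cancel (by simp) (by simp), ENNReal.rpow_inv_rpow hq0.ne']
  have hind : ∀ {h : E → ℝ≥0∞}, Measurable h → Measurable fun z : ℝ × E =>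
      ({t : ℝ | ENNReal.ofReal t < h z.2}.indicator (1 : ℝ → ℝ≥0∞) z.1) := by
    intro h hh
    have : MeasurableSet {z : ℝ × E | ENNReal.ofReal z.1 < h z.2} :=
      measurableSet_lt (ENNReal.measurable_ofReal.comp measurable_fst) (hh.comp measurable_snd)
    exact (measurable_one.indicator this : Measurable
      ({z : ℝ × E | ENNReal.ofReal z.1 < h z.2}.indicator (1 : ℝ × E → ℝ≥0∞)))
  have hpow : ∀ s : ℝ, Measurable fun t : ℝ => ENNReal.ofReal (t ^ s) := fun s => by fun_prop
  have hlevel : ∀ t : ℝ, 0 < t → ENNReal.ofReal t * ν {x | ENNReal.ofReal t < g x} ≤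
      K * ∫⁻ x, f x * ({t : ℝ | ENNReal.ofReal t < f x}.indicator 1 t) ∂κ := by
    intro t ht
    have hm : MeasurableSet {y | ENNReal.ofReal t < f y} := measurableSet_lt measurable_const hf
    calc ENNReal.ofReal t * ν {x | ENNReal.ofReal t < g x}
        ≤ ENNReal.ofReal t * ν {x | ENNReal.ofReal t <
            centeredMax μ ({y | ENNReal.ofReal t < f y}.indicator f) x} := by
          refine mul_le_mul' le_rfl (measure_mono fun x (hx : ENNReal.ofReal t < g x) => ?_)
          have h1 := hx.trans_le (hgle x)
          rw [ENNReal.lt_div_iff_mul_lt (by simp) (by simp), mul_two] at h1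
          exact lt_of_add_lt_add_right (h1.trans_le (centeredMax_le_add μ f _ x))
      _ ≤ K * ∫⁻ x, {y | ENNReal.ofReal t < f y}.indicator f x ∂κ :=
          hweak _ (hf.indicator hm) _
      _ = _ := by
          congr 2 with x
          by_cases h : ENNReal.ofReal t < f x <;> simp [h]
  calc ∫⁻ x, centeredMax μ f x ^ q ∂ν
      = 2 ^ q * ∫⁻ x, g x ^ q ∂ν := by
        rw [hGeq, ← lintegral_const_mul _ (hgm.pow_const _)]
        simp_rw [hGg]
    _ ≤ 2 ^ q * ∫⁻ x, ENNReal.ofReal q * (∫⁻ t in Ioi (0 : ℝ), ENNReal.ofReal (t ^ (q - 1)) *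
          ({t : ℝ | ENNReal.ofReal t < g x}.indicator 1 t)) ∂ν := by
        gcongr with x
        exact le_lintegral_Ioi_rpow_mul_indicator hq0 _
    _ = 2 ^ q * ENNReal.ofReal q * ∫⁻ t in Ioi (0 : ℝ), ENNReal.ofReal (t ^ (q - 1)) *
          ν {x | ENNReal.ofReal t < g x} := by
        rw [lintegral_const_mul' _ _ (by simp), mul_assoc, lintegral_lintegral_swap]
        · congr 3 with t
          rw [lintegral_const_mul' _ _ (by simp), ← lintegral_indicator_one
            (measurableSet_lt measurable_const hgm)]
          rfl
        · exact (((hpow _).comp measurable_snd).mul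
            ((hind hgm).comp measurable_swap)).aemeasurable
    _ ≤ 2 ^ q * ENNReal.ofReal q * ∫⁻ t in Ioi (0 : ℝ), K * (ENNReal.ofReal (t ^ (q - 1 - 1)) *
          ∫⁻ x, f x * ({t : ℝ | ENNReal.ofReal t < f x}.indicator 1 t) ∂κ) := by
        refine mul_le_mul' le_rfl ?_
        refine setLIntegral_mono' measurableSet_Ioi fun t (ht : 0 < t) => ?_
        calc ENNReal.ofReal (t ^ (q - 1)) * ν {x | ENNReal.ofReal t < g x}
            = ENNReal.ofReal (t ^ (q - 1 - 1)) *
              (ENNReal.ofReal t * ν {x | ENNReal.ofReal t < g x}) := by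
              rw [← mul_assoc, ← ENNReal.ofReal_mul (by positivity), Real.rpow_sub_one ht.ne' (q - 1),
                div_mul_cancel₀ _ ht.ne']
          _ ≤ ENNReal.ofReal (t ^ (q - 1 - 1)) * (K * ∫⁻ x, f x *
              ({t : ℝ | ENNReal.ofReal t < f x}.indicator 1 t) ∂κ) :=
              mul_le_mul' le_rfl (hlevel t ht)
          _ = _ := mul_left_comm _ _ _
    _ = 2 ^ q * ENNReal.ofReal q * K * ∫⁻ x, (∫⁻ t in Ioi (0 : ℝ), f x *
          (ENNReal.ofReal (t ^ (q - 1 - 1)) *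
          ({t : ℝ | ENNReal.ofReal t < f x}.indicator 1 t))) ∂κ := by
        have hm : Measurable fun z : ℝ × E => f z.2 *
            ({t : ℝ | ENNReal.ofReal t < f z.2}.indicator (1 : ℝ → ℝ≥0∞) z.1) :=
          (hf.comp measurable_snd).mul (hind hf)
        rw [lintegral_const_mul (μ := volume.restrict (Ioi (0 : ℝ))) K
            (f := fun t : ℝ => ENNReal.ofReal (t ^ (q - 1 - 1)) *
              ∫⁻ x, f x * ({t : ℝ | ENNReal.ofReal t < f x}.indicator 1 t) ∂κ)
            ((hpow _).mul hm.lintegral_prod_right'), mul_assoc _ K,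
          lintegral_lintegral_swap]
        · congr 4 with t
          rw [← lintegral_const_mul' _ _ (by simp)]
          congr 1 with x
          ring
        · exact ((hf.comp measurable_fst).mul (((hpow _).comp measurable_snd).mul
            ((hind hf).comp measurable_swap))).aemeasurable
    _ ≤ 2 ^ q * ENNReal.ofReal q * K * ∫⁻ x, ENNReal.ofReal (q - 1)⁻¹ * f x ^ q ∂κ := by
        gcongr with x
        rw [lintegral_const_mul]
        · calc _ ≤ f x * (ENNReal.ofReal (q - 1)⁻¹ * f x ^ (q - 1)) := by
                gcongr
                exact lintegral_Ioi_rpow_mul_indicator_le (by linarith) _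
            _ = ENNReal.ofReal (q - 1)⁻¹ * (f x ^ (1 : ℝ) * f x ^ (q - 1)) := by
                rw [ENNReal.rpow_one]; ring
            _ = _ := by
                rw [← ENNReal.rpow_add_of_nonneg _ _ zero_le_one (by linarith)]
                congr 2
                ring
        · exact (hpow _).mul ((hind hf).comp (measurable_id.prodMk measurable_const))
    _ = _ := by
        rw [lintegral_const_mul _ (hf.pow_const _)]
        ring

lemma lowerSemicontinuous_measure_ball {E : Type*} [PseudoMetricSpace E] [MeasurableSpace E]
    (κ : Measure E) (r : ℝ) : LowerSemicontinuous fun x => κ (ball x r) := by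
  intro x y (hy : y < κ (ball x r))
  have hmono : Monotone fun n : ℕ => ball x (r - 1 / ((n : ℝ) + 1)) := fun m n hmn =>
    ball_subset_ball (by linarith [Nat.one_div_le_one_div (α := ℝ) hmn])
  have hU : ball x r = ⋃ n : ℕ, ball x (r - 1 / ((n : ℝ) + 1)) := by
    refine Subset.antisymm (fun z hz => ?_) (iUnion_subset fun n => ball_subset_ball ?_)
    · obtain ⟨n, hn⟩ := exists_nat_one_div_lt (sub_pos.2 (mem_ball.1 hz))
      exact mem_iUnion.2 ⟨n, mem_ball.2 (by linarith)⟩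
    · linarith [Nat.one_div_pos_of_nat (α := ℝ) (n := n)]
  rw [hU, hmono.measure_iUnion, lt_iSup_iff] at hy
  obtain ⟨n, hn⟩ := hy
  filter_upwards [ball_mem_nhds x (Nat.one_div_pos_of_nat (α := ℝ) (n := n))] with z hz
  refine hn.trans_le (measure_mono (ball_subset_ball' ?_))
  rw [mem_ball, dist_comm] at hz
  linarith

section Haar

variable {E : Type*} [NormedAddCommGroup E] [NormedSpace ℝ E] [FiniteDimensional ℝ E]
  [MeasurableSpace E] [BorelSpace E] (μ : Measure E) [μ.IsAddHaarMeasure]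

lemma lowerSemicontinuous_centeredMax (f : E → ℝ≥0∞) :
    LowerSemicontinuous (centeredMax μ f) := by
  intro x y (hy : y < centeredMax μ f x)
  rw [centeredMax, lt_iSup_iff] at hy
  obtain ⟨r, hr⟩ := hy
  have h0 : μ (ball (0 : E) r) ≠ 0 := (measure_ball_pos μ 0 r.2).ne'
  have htop : μ (ball (0 : E) r) ≠ ∞ := measure_ball_lt_top.ne
  have key : ∀ z, y < (μ (ball z r))⁻¹ * ∫⁻ y in ball z r, f y ∂μ ↔
      y * μ (ball (0 : E) r) < μ.withDensity f (ball z r) := fun z => by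
    rw [withDensity_apply _ measurableSet_ball, Measure.addHaar_ball_center, mul_comm,
      ← div_eq_mul_inv, ENNReal.lt_div_iff_mul_lt (Or.inl h0) (Or.inl htop)]
  filter_upwards [lowerSemicontinuous_measure_ball (μ.withDensity f) r x _ ((key x).1 hr)]
    with z hz
  exact ((key z).2 hz).trans_le (le_iSup (fun r : {r : ℝ // 0 < r} =>
    (μ (ball z r.1))⁻¹ * ∫⁻ y in ball z r.1, f y ∂μ) r)

lemma measurable_centeredMax (f : E → ℝ≥0∞) :
    Measurable (centeredMax μ f) :=
  (lowerSemicontinuous_centeredMax μ f).measurable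

/-- The average of `w` over a ball is controlled by its maximal function at every point of the
ball. -/
lemma lintegral_ball_le_centeredMax (w : E → ℝ≥0∞) {x y : E} {r : ℝ} (hy : y ∈ ball x r) :
    (μ (ball x r))⁻¹ * ∫⁻ z in ball x r, w z ∂μ ≤
      2 ^ Module.finrank ℝ E * centeredMax μ w y := by
  have hr : 0 < r := pos_of_mem_ball hy
  have h2 : μ (ball y (2 * r)) = 2 ^ Module.finrank ℝ E * μ (ball x r) := by
    rw [Measure.addHaar_ball_mul_of_pos μ y two_pos, Measure.addHaar_ball_center μ x,
      ENNReal.ofReal_pow (by norm_num), ENNReal.ofReal_ofNat]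
  calc (μ (ball x r))⁻¹ * ∫⁻ z in ball x r, w z ∂μ
      = 2 ^ Module.finrank ℝ E *
          ((μ (ball y (2 * r)))⁻¹ * ∫⁻ z in ball x r, w z ∂μ) := by
        rw [h2, ENNReal.mul_inv (by simp) (by simp), ← mul_assoc, ← mul_assoc,
          ENNReal.mul_inv_cancel (by simp) (by simp), one_mul]
    _ ≤ 2 ^ Module.finrank ℝ E *
          ((μ (ball y (2 * r)))⁻¹ * ∫⁻ z in ball y (2 * r), w z ∂μ) := by
        gcongr
        refine ball_subset_ball' ?_
        rw [mem_ball, dist_comm] at hy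
        linarith
    _ ≤ _ := by
        gcongr
        exact le_iSup (fun r : {r : ℝ // 0 < r} =>
          (μ (ball y r.1))⁻¹ * ∫⁻ z in ball y r.1, w z ∂μ) ⟨2 * r, by positivity⟩

/-- Weighted weak type `(1, 1)` bound for the maximal function. -/
lemma exists_weakType_weighted : ∃ K : ℝ≥0∞, K ≠ ∞ ∧ ∀ w : E → ℝ≥0∞, Measurable w →
    ∀ f : E → ℝ≥0∞, Measurable f → ∀ c : ℝ≥0∞,
      c * μ.withDensity w {x | c < centeredMax μ f x} ≤
        K * ∫⁻ x, f x ∂(μ.withDensity (centeredMax μ w)) := by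
  obtain ⟨N, hN⟩ := exists_besicovitch_const E
  refine ⟨N * 2 ^ Module.finrank ℝ E, by finiteness, fun w hw f hf c => ?_⟩
  have := hN (μ.withDensity w)
    ((2 : ℝ≥0∞) ^ Module.finrank ℝ E • (μ.withDensity (centeredMax μ w)).withDensity f) c
    {x | c < centeredMax μ f x} fun x hx => by
      rw [mem_ofPred_eq, centeredMax, lt_iSup_iff] at hx
      obtain ⟨⟨r, hr⟩, h⟩ := hx
      refine ⟨r, hr, ?_⟩
      rw [Measure.smul_apply, withDensity_apply _ measurableSet_ball,
        withDensity_apply _ measurableSet_ball, restrict_withDensity measurableSet_ball,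
        lintegral_withDensity_eq_lintegral_mul _ (measurable_centeredMax μ w) hf, smul_eq_mul,
        ← lintegral_const_mul _ ((measurable_centeredMax μ w).mul hf)]
      calc c * ∫⁻ z in ball x r, w z ∂μ
          ≤ ((μ (ball x r))⁻¹ * ∫⁻ y in ball x r, f y ∂μ) * ∫⁻ z in ball x r, w z ∂μ := by
            gcongr
        _ = ∫⁻ y in ball x r, ((μ (ball x r))⁻¹ * ∫⁻ z in ball x r, w z ∂μ) * f y ∂μ := by
            rw [lintegral_const_mul _ hf]
            ring
        _ ≤ _ := by
            refine setLIntegral_mono' measurableSet_ball fun y hy => ?_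
            rw [Pi.mul_apply, ← mul_assoc]
            exact mul_le_mul' (lintegral_ball_le_centeredMax μ w hy) le_rfl
  simpa [mul_assoc] using this

/-- Fefferman–Stein weighted inequality. -/
lemma exists_lintegral_centeredMax_rpow_mul_le {q : ℝ} (hq : 1 < q) : ∃ K : ℝ≥0∞, K ≠ ∞ ∧
    ∀ w : E → ℝ≥0∞, Measurable w → ∀ f : E → ℝ≥0∞, Measurable f →
      ∫⁻ x, centeredMax μ f x ^ q * w x ∂μ ≤ K * ∫⁻ x, f x ^ q * centeredMax μ w x ∂μ := by
  obtain ⟨K, hK, h⟩ := exists_weakType_weighted μ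
  refine ⟨2 ^ q * ENNReal.ofReal q * K * ENNReal.ofReal (q - 1)⁻¹, by finiteness,
    fun w hw f hf => ?_⟩
  have := lintegral_centeredMax_rpow_le (h w hw) hq hf
  rw [lintegral_withDensity_eq_lintegral_mul _ hw ((measurable_centeredMax μ f).pow_const _),
    lintegral_withDensity_eq_lintegral_mul _ (measurable_centeredMax μ w) (hf.pow_const _)]
    at this
  simpa only [Pi.mul_apply, mul_comm (w _), mul_comm (centeredMax μ w _)] using this

variable (E) in
lemma exists_lintegral_centeredMax_rpow_le {q : ℝ} (hq : 1 < q) : ∃ K : ℝ≥0∞, K ≠ ∞ ∧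
    ∀ (ν : Measure E) [SFinite ν] (f : E → ℝ≥0∞), Measurable f →
      ∫⁻ x, centeredMax ν f x ^ q ∂ν ≤ K * ∫⁻ x, f x ^ q ∂ν := by
  obtain ⟨N, h⟩ := exists_weakType_centeredMax E
  exact ⟨2 ^ q * ENNReal.ofReal q * N * ENNReal.ofReal (q - 1)⁻¹, by finiteness,
    fun ν _ f hf => lintegral_centeredMax_rpow_le (h ν) hq hf⟩

end Haar

lemma sum_range_half_pow_rpow_le {r : ℝ} (hr : 1 ≤ r) (n : ℕ) (a : ℕ → ℝ≥0∞) :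
    (∑ k ∈ Finset.range n, 2⁻¹ ^ (k + 1) * a k) ^ r ≤
      ∑ k ∈ Finset.range n, 2⁻¹ ^ (k + 1) * a k ^ r := by
  induction n generalizing a with
  | zero => simp [show 0 < r by linarith]
  | succ n ih =>
    simp only [Finset.sum_range_succ', pow_succ' (2⁻¹ : ℝ≥0∞), mul_assoc]
    simp only [← Finset.mul_sum, pow_zero, one_mul]
    refine (ENNReal.rpow_arith_mean_le_arith_mean2_rpow _ _ _ _
      ENNReal.inv_two_add_inv_two hr).trans ?_
    gcongr
    simpa only [pow_succ' (2⁻¹ : ℝ≥0∞), mul_assoc, ← Finset.mul_sum] using ih fun k => a (k + 1)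

lemma tsum_half_pow_rpow_le {r : ℝ} (hr : 1 ≤ r) (a : ℕ → ℝ≥0∞) :
    (∑' k, 2⁻¹ ^ (k + 1) * a k) ^ r ≤ ∑' k, 2⁻¹ ^ (k + 1) * a k ^ r := by
  have hr0 : 0 < r := by linarith
  rw [← ENNReal.le_rpow_inv_iff hr0, ENNReal.tsum_eq_iSup_nat]
  refine iSup_le fun n => ?_
  rw [ENNReal.le_rpow_inv_iff hr0]
  exact (sum_range_half_pow_rpow_le hr n a).trans (ENNReal.sum_le_tsum _)

lemma tsum_half_pow : ∑' k : ℕ, (2⁻¹ : ℝ≥0∞) ^ (k + 1) = 1 := by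
  simp_rw [pow_succ']
  rw [ENNReal.tsum_mul_left, ENNReal.tsum_geometric, ENNReal.one_sub_inv_two, inv_inv,
    ENNReal.inv_mul_cancel (by simp) (by simp)]

lemma centeredMax_const_mul {E : Type*} [PseudoMetricSpace E] [MeasurableSpace E] (μ : Measure E)
    {f : E → ℝ≥0∞} (hf : Measurable f) (c : ℝ≥0∞) (x : E) :
    centeredMax μ (fun y => c * f y) x = c * centeredMax μ f x := by
  simp_rw [centeredMax, lintegral_const_mul _ hf, ENNReal.mul_iSup, mul_left_comm c]

lemma centeredMax_tsum_le {E : Type*} [PseudoMetricSpace E] [MeasurableSpace E] (μ : Measure E)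
    {f : ℕ → E → ℝ≥0∞} (hf : ∀ k, Measurable (f k)) (x : E) :
    centeredMax μ (fun y => ∑' k, f k y) x ≤ ∑' k, centeredMax μ (f k) x := by
  refine iSup_le fun r => ?_
  rw [lintegral_tsum fun k => (hf k).aemeasurable, ← ENNReal.tsum_mul_left]
  exact ENNReal.tsum_le_tsum fun k => le_iSup (fun r : {r : ℝ // 0 < r} =>
    (μ (ball x r.1))⁻¹ * ∫⁻ z in ball x r.1, f k z ∂μ) r

section Weights

variable {E : Type*} [NormedAddCommGroup E] [NormedSpace ℝ E] [FiniteDimensional ℝ E]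
  [MeasurableSpace E] [BorelSpace E] (μ : Measure E) [μ.IsAddHaarMeasure]

/-- The Rubio de Francia algorithm: every `φ` has an `A₁` majorant with comparable `L^r` norm. -/
lemma exists_A1_majorant {r : ℝ} (hr : 1 < r) : ∃ A : ℝ≥0∞, A ≠ ∞ ∧
    ∀ φ : E → ℝ≥0∞, Measurable φ → ∃ w : E → ℝ≥0∞, Measurable w ∧ φ ≤ w ∧
      (∀ x, centeredMax μ w x ≤ A * w x) ∧ ∫⁻ x, w x ^ r ∂μ ≤ 2 ^ r * ∫⁻ x, φ x ^ r ∂μ := by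
  have hr0 : 0 < r := by linarith
  obtain ⟨K, hK, hM⟩ := exists_lintegral_centeredMax_rpow_le E hr
  set B : ℝ≥0∞ := K + 1 with hB
  have hB0 : B ≠ 0 := by simp [hB]
  have hBtop : B ≠ ∞ := by finiteness
  have hKB : K ≤ B ^ r :=
    (self_le_add_right K 1).trans (ENNReal.le_rpow_self_of_one_le (by simp) hr.le)
  refine ⟨2 * B, by finiteness, fun φ hφ => ?_⟩
  let a : ℕ → E → ℝ≥0∞ := fun n =>
    Nat.rec φ (fun _ g x => B⁻¹ * centeredMax μ g x) n
  have ha0 : a 0 = φ := rfl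
  have has : ∀ n x, a (n + 1) x = B⁻¹ * centeredMax μ (a n) x := fun n x => rfl
  have ham : ∀ n, Measurable (a n) := by
    intro n
    induction n with
    | zero => exact hφ
    | succ n _ => exact (measurable_centeredMax μ (a n)).const_mul _
  have haint : ∀ n, ∫⁻ x, a n x ^ r ∂μ ≤ ∫⁻ x, φ x ^ r ∂μ := by
    intro n
    induction n with
    | zero => exact le_rfl
    | succ n ih =>
      simp_rw [has, ENNReal.mul_rpow_of_nonneg _ _ hr0.le]
      rw [lintegral_const_mul _ ((measurable_centeredMax μ (a n)).pow_const _), ENNReal.inv_rpow]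
      calc (B ^ r)⁻¹ * ∫⁻ x, centeredMax μ (a n) x ^ r ∂μ
          ≤ (B ^ r)⁻¹ * (B ^ r * ∫⁻ x, a n x ^ r ∂μ) := by
            gcongr
            exact (hM μ _ (ham n)).trans (by gcongr)
        _ ≤ 1 * ∫⁻ x, a n x ^ r ∂μ := by
            rw [← mul_assoc]
            gcongr
            exact ENNReal.inv_mul_le_one _
        _ ≤ _ := by rwa [one_mul]
  refine ⟨fun x => ∑' n, 2⁻¹ ^ n * a n x,
    Measurable.tsum fun n => (ham n).const_mul _, fun x => ?_, fun x => ?_, ?_⟩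
  · refine le_trans ?_ (ENNReal.le_tsum 0)
    simp [ha0]
  · calc centeredMax μ (fun x => ∑' n, 2⁻¹ ^ n * a n x) x
        ≤ ∑' n, 2⁻¹ ^ n * centeredMax μ (a n) x := by
          refine (centeredMax_tsum_le μ (fun n => (ham n).const_mul _) x).trans_eq ?_
          simp_rw [centeredMax_const_mul μ (ham _)]
      _ = ∑' n, 2 * B * (2⁻¹ ^ (n + 1) * a (n + 1) x) := by
          congr 1 with n
          rw [has, pow_succ]
          calc _ = (2 * 2⁻¹) * (B * B⁻¹) * (2⁻¹ ^ n * centeredMax μ (a n) x) := by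
                rw [ENNReal.mul_inv_cancel (by simp) (by simp), ENNReal.mul_inv_cancel hB0 hBtop,
                  one_mul, one_mul]
            _ = _ := by ring
      _ = 2 * B * ∑' n, 2⁻¹ ^ (n + 1) * a (n + 1) x := ENNReal.tsum_mul_left
      _ ≤ 2 * B * ∑' n, 2⁻¹ ^ n * a n x := by
          exact mul_le_mul' le_rfl (ENNReal.tsum_comp_le_tsum_of_injective
            (add_left_injective 1) fun n => 2⁻¹ ^ n * a n x)
  · calc ∫⁻ x, (∑' n, 2⁻¹ ^ n * a n x) ^ r ∂μ
        = ∫⁻ x, (2 * ∑' n, 2⁻¹ ^ (n + 1) * a n x) ^ r ∂μ := by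
          congr 2 with x
          congr 1
          rw [← ENNReal.tsum_mul_left]
          congr 1 with n
          rw [pow_succ', ← mul_assoc, ← mul_assoc, ENNReal.mul_inv_cancel (by simp) (by simp),
            one_mul]
      _ ≤ ∫⁻ x, 2 ^ r * ∑' n, 2⁻¹ ^ (n + 1) * a n x ^ r ∂μ := by
          gcongr with x
          rw [ENNReal.mul_rpow_of_nonneg _ _ hr0.le]
          gcongr
          exact tsum_half_pow_rpow_le hr.le _
      _ = 2 ^ r * ∑' n, 2⁻¹ ^ (n + 1) * ∫⁻ x, a n x ^ r ∂μ := by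
          rw [lintegral_const_mul' _ _ (by finiteness),
            lintegral_tsum fun n => (((ham n).pow_const _).const_mul _).aemeasurable]
          simp_rw [lintegral_const_mul _ ((ham _).pow_const r)]
      _ ≤ 2 ^ r * ∑' n : ℕ, 2⁻¹ ^ (n + 1) * ∫⁻ x, φ x ^ r ∂μ := by
          exact mul_le_mul' le_rfl (ENNReal.tsum_le_tsum fun n => mul_le_mul' le_rfl (haint n))
      _ = _ := by rw [ENNReal.tsum_mul_right, tsum_half_pow, one_mul]

lemma centeredMax_pos {w : E → ℝ≥0∞} (hw : ∫⁻ x, w x ∂μ ≠ 0) (x : E) :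
    0 < centeredMax μ w x := by
  refine pos_iff_ne_zero.2 fun h => hw ?_
  have hball : ∀ n : ℕ, μ.withDensity w (ball x n) = 0 := by
    intro n
    rw [withDensity_apply _ measurableSet_ball]
    rcases n.eq_zero_or_pos with rfl | hn
    · simp
    · have h1 := le_iSup (fun r : {r : ℝ // 0 < r} =>
        (μ (ball x r.1))⁻¹ * ∫⁻ y in ball x r.1, w y ∂μ) ⟨n, by exact_mod_cast hn⟩
      have h2 := le_zero_iff.1 (h1.trans_eq h)
      exact (mul_eq_zero.1 h2).resolve_left (ENNReal.inv_ne_zero.2 measure_ball_lt_top.ne)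
  rw [← setLIntegral_univ, ← withDensity_apply _ MeasurableSet.univ, ← iUnion_ball_nat x]
  exact measure_iUnion_null hball

/-- If `w` is an `A₁` weight, then `M f` is controlled by the maximal function of `f / w`
with respect to the measure of density `w`. -/
lemma centeredMax_le_mul_centeredMax_withDensity {A : ℝ≥0∞} (hA : A ≠ ∞) {w : E → ℝ≥0∞}
    (hw : Measurable w) (hw0 : ∀ x, 0 < w x) (hwtop : ∀ᵐ x ∂μ, w x < ∞)
    (hwA : ∀ x, centeredMax μ w x ≤ A * w x) {f : E → ℝ≥0∞} (hf : Measurable f) {x : E}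
    (hx : w x < ∞) :
    centeredMax μ f x ≤ A * w x * centeredMax (μ.withDensity w) (fun y => f y / w y) x := by
  refine iSup_le fun r => ?_
  set ν := μ.withDensity w with hν
  set I := ∫⁻ y in ball x r, f y / w y ∂ν with hI
  have hgm : Measurable fun y => f y / w y := hf.div hw
  have hIf : ∫⁻ y in ball x r, f y ∂μ = I := by
    rw [hI, hν, restrict_withDensity measurableSet_ball,
      lintegral_withDensity_eq_lintegral_mul _ hw hgm]
    refine lintegral_congr_ae ?_
    filter_upwards [ae_restrict_of_ae hwtop] with y hy
    rw [Pi.mul_apply, ENNReal.mul_div_cancel (hw0 y).ne' hy.ne]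
  have hle : (μ (ball x r))⁻¹ * ν (ball x r) ≤ A * w x := by
    rw [hν, withDensity_apply _ measurableSet_ball]
    exact (le_iSup (fun r : {r : ℝ // 0 < r} =>
        (μ (ball x r.1))⁻¹ * ∫⁻ y in ball x r.1, w y ∂μ) r).trans (hwA x)
  rcases eq_or_ne (ν (ball x r)) 0 with h0 | h0
  · rw [hIf, hI, Measure.restrict_eq_zero.2 h0]
    simp
  have htop : ν (ball x r) ≠ ∞ := by
    intro h
    rw [h, ENNReal.mul_top (ENNReal.inv_ne_zero.2 measure_ball_lt_top.ne), top_le_iff] at hle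
    exact ENNReal.mul_ne_top hA hx.ne hle
  calc (μ (ball x r))⁻¹ * ∫⁻ y in ball x r, f y ∂μ
      = ((μ (ball x r))⁻¹ * ν (ball x r)) * ((ν (ball x r))⁻¹ * I) := by
        rw [hIf, mul_assoc, ← mul_assoc (ν _), ENNReal.mul_inv_cancel h0 htop, one_mul]
    _ ≤ _ := mul_le_mul' hle (le_iSup (fun r : {r : ℝ // 0 < r} =>
        (ν (ball x r.1))⁻¹ * ∫⁻ y in ball x r.1, f y / w y ∂ν) r)

/-- The maximal function is bounded on `L^q(w^{1-q})` when `w` is an `A₁` weight. -/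
lemma exists_lintegral_centeredMax_rpow_mul_rpow_le {q : ℝ} (hq : 1 < q) {A : ℝ≥0∞}
    (hA : A ≠ ∞) : ∃ K : ℝ≥0∞, K ≠ ∞ ∧ ∀ w : E → ℝ≥0∞, Measurable w → (∀ x, 0 < w x) →
      (∀ᵐ x ∂μ, w x < ∞) → (∀ x, centeredMax μ w x ≤ A * w x) →
      ∀ f : E → ℝ≥0∞, Measurable f →
        ∫⁻ x, centeredMax μ f x ^ q * w x ^ (1 - q) ∂μ ≤
          K * ∫⁻ x, f x ^ q * w x ^ (1 - q) ∂μ := by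
  have hq0 : 0 < q := by linarith
  obtain ⟨K, hK, hM⟩ := exists_lintegral_centeredMax_rpow_le E hq
  refine ⟨A ^ q * K, by finiteness, fun w hw hw0 hwtop hwA f hf => ?_⟩
  set ν := μ.withDensity w with hν
  set g : E → ℝ≥0∞ := fun y => f y / w y with hg
  have hgm : Measurable g := hf.div hw
  calc ∫⁻ x, centeredMax μ f x ^ q * w x ^ (1 - q) ∂μ
      ≤ ∫⁻ x, A ^ q * (w x * centeredMax ν g x ^ q) ∂μ := by
        refine lintegral_mono_ae ?_
        filter_upwards [hwtop] with x hx
        calc centeredMax μ f x ^ q * w x ^ (1 - q)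
            ≤ (A * w x * centeredMax ν g x) ^ q * w x ^ (1 - q) := by
              gcongr
              exact centeredMax_le_mul_centeredMax_withDensity μ hA hw hw0 hwtop hwA hf hx
          _ = A ^ q * ((w x ^ q * w x ^ (1 - q)) * centeredMax ν g x ^ q) := by
              rw [ENNReal.mul_rpow_of_nonneg _ _ hq0.le, ENNReal.mul_rpow_of_nonneg _ _ hq0.le]
              ring
          _ = _ := by
              rw [← ENNReal.rpow_add _ _ (hw0 x).ne' hx.ne, add_sub_cancel, ENNReal.rpow_one]
    _ = A ^ q * ∫⁻ x, centeredMax ν g x ^ q ∂ν := by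
        rw [lintegral_const_mul' _ _ (by finiteness), hν,
          lintegral_withDensity_eq_lintegral_mul_non_measurable _ hw hwtop]
        rfl
    _ ≤ A ^ q * (K * ∫⁻ x, g x ^ q ∂ν) := by
        gcongr
        exact hM ν g hgm
    _ = A ^ q * K * ∫⁻ x, f x ^ q * w x ^ (1 - q) ∂μ := by
        rw [hν, lintegral_withDensity_eq_lintegral_mul _ hw (hgm.pow_const _), mul_assoc]
        congr 2
        refine lintegral_congr_ae ?_
        filter_upwards [hwtop] with x hx
        rw [Pi.mul_apply, hg, ENNReal.div_rpow_of_nonneg _ _ hq0.le,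
          ENNReal.rpow_sub _ _ (hw0 x).ne' hx.ne, ENNReal.rpow_one]
        simp only [div_eq_mul_inv]
        ring

end Weights

lemma ENNReal.le_rpow_mul_of_le_mul_rpow {a b : ℝ} (hab : a.HolderConjugate b) {X Y D : ℝ≥0∞}
    (hX : X ≠ ∞) (h : X ≤ D * Y ^ (1 / a) * X ^ (1 / b)) : X ≤ D ^ a * Y := by
  rcases eq_or_ne X 0 with rfl | h0
  · exact zero_le
  have ha : 0 < a := hab.pos
  have hb0 : X ^ (1 / b) ≠ 0 := by simp [h0, hX]
  have hbtop : X ^ (1 / b) ≠ ∞ := ENNReal.rpow_ne_top_of_ne_zero h0 hX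
  have hsplit : X = X ^ (1 / a) * X ^ (1 / b) := by
    rw [← ENNReal.rpow_add _ _ h0 hX, one_div, one_div, hab.inv_add_inv_eq_one, ENNReal.rpow_one]
  nth_rewrite 1 [hsplit] at h
  have h1 := (ENNReal.mul_le_mul_iff_left hb0 hbtop).1 h
  calc X = (X ^ (1 / a)) ^ a := by rw [one_div, ENNReal.rpow_inv_rpow ha.ne']
    _ ≤ (D * Y ^ (1 / a)) ^ a := by gcongr
    _ = D ^ a * Y := by
      rw [ENNReal.mul_rpow_of_nonneg _ _ ha.le, one_div, ENNReal.rpow_inv_rpow ha.ne']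

lemma centeredMax_eq_zero_of_ae_eq_zero {E : Type*} [PseudoMetricSpace E] [MeasurableSpace E]
    {μ : Measure E} {f : E → ℝ≥0∞} (hf : f =ᵐ[μ] 0) (x : E) :
    centeredMax μ f x = 0 := by
  refine le_zero_iff.1 (iSup_le fun r => ?_)
  rw [lintegral_congr_ae (ae_restrict_of_ae hf)]
  simp

section VectorValued

variable {E : Type*} [NormedAddCommGroup E] [NormedSpace ℝ E] [FiniteDimensional ℝ E]
  [MeasurableSpace E] [BorelSpace E] (μ : Measure E) [μ.IsAddHaarMeasure]

/-- A weighted `L¹` bound yields `L^a` bounds for `a > 1`. -/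
lemma exists_lintegral_rpow_le_of_one_lt {a : ℝ} (ha : 1 < a) {K : ℝ≥0∞} (hK : K ≠ ∞) :
    ∃ C : ℝ≥0∞, C ≠ ∞ ∧ ∀ S T : E → ℝ≥0∞, Measurable S → Measurable T →
      (∀ w : E → ℝ≥0∞, Measurable w →
        ∫⁻ x, S x * w x ∂μ ≤ K * ∫⁻ x, T x * centeredMax μ w x ∂μ) →
      ∫⁻ x, S x ^ a ∂μ ≤ C * ∫⁻ x, T x ^ a ∂μ := by
  have ha0 : 0 < a := by linarith
  set b := a.conjExponent with hb
  have hab : a.HolderConjugate b := Real.HolderConjugate.conjExponent ha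
  have hb0 : 0 < b := hab.symm.pos
  obtain ⟨L, hL, hM⟩ := exists_lintegral_centeredMax_rpow_le E hab.symm.lt
  refine ⟨(K * L ^ (1 / b)) ^ a, by finiteness, fun S T hS hT h => ?_⟩
  let H : ℕ → E → ℝ≥0∞ := fun n => (ball (0 : E) n).indicator fun x => min (S x) n
  have hHm : ∀ n, Measurable (H n) := fun n =>
    (hS.min measurable_const).indicator measurableSet_ball
  have hHS : ∀ n x, H n x ≤ S x := fun n x =>
    (indicator_le_self _ _ _).trans (min_le_left _ _)
  have hpow : ∀ n x, H n x ^ a = H n x * H n x ^ (a - 1) := fun n x => by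
    nth_rewrite 2 [← ENNReal.rpow_one (H n x)]
    rw [← ENNReal.rpow_add_of_nonneg _ _ zero_le_one (by linarith), add_sub_cancel]
  have hexp : (a - 1) * b = a := by
    rw [hb, Real.conjExponent]
    field_simp [show a - 1 ≠ 0 by linarith]
  have hHfin : ∀ n, ∫⁻ x, H n x ^ a ∂μ ≠ ∞ := fun n => by
    refine ne_top_of_le_ne_top
      (b := ∫⁻ x, (ball (0 : E) n).indicator (fun _ => (n : ℝ≥0∞) ^ a) x ∂μ) ?_ ?_
    · rw [lintegral_indicator_const measurableSet_ball]
      exact ENNReal.mul_ne_top (by finiteness) measure_ball_lt_top.ne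
    · gcongr with x
      by_cases hx : x ∈ ball (0 : E) n
      · simp only [H, indicator_of_mem hx]
        gcongr
        exact min_le_right _ _
      · simp [H, indicator_of_notMem hx, ha0]
  have hbound : ∀ n, ∫⁻ x, H n x ^ a ∂μ ≤ (K * L ^ (1 / b)) ^ a * ∫⁻ x, T x ^ a ∂μ := by
    intro n
    refine ENNReal.le_rpow_mul_of_le_mul_rpow hab (hHfin n) ?_
    have hwm : Measurable fun x => H n x ^ (a - 1) := (hHm n).pow_const _
    calc ∫⁻ x, H n x ^ a ∂μ ≤ ∫⁻ x, S x * H n x ^ (a - 1) ∂μ := by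
          gcongr with x
          rw [hpow]
          gcongr
          exact hHS n x
      _ ≤ K * ∫⁻ x, T x * centeredMax μ (fun x => H n x ^ (a - 1)) x ∂μ := h _ hwm
      _ ≤ K * ((∫⁻ x, T x ^ a ∂μ) ^ (1 / a) *
            (∫⁻ x, centeredMax μ (fun x => H n x ^ (a - 1)) x ^ b ∂μ) ^ (1 / b)) := by
          gcongr
          exact ENNReal.lintegral_mul_le_Lp_mul_Lq μ hab hT.aemeasurable
            (measurable_centeredMax μ _).aemeasurable
      _ ≤ K * ((∫⁻ x, T x ^ a ∂μ) ^ (1 / a) * (L * ∫⁻ x, H n x ^ a ∂μ) ^ (1 / b)) := by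
          gcongr
          refine (hM μ _ hwm).trans_eq ?_
          simp_rw [← ENNReal.rpow_mul, hexp]
      _ = _ := by
          rw [ENNReal.mul_rpow_of_nonneg _ _ (by positivity)]
          ring
  have hlim : ∀ x, Tendsto (fun n => H n x ^ a) atTop (𝓝 (S x ^ a)) := fun x => by
    refine (ENNReal.continuous_rpow_const.tendsto _).comp ?_
    have h1 : Tendsto (fun n : ℕ => min (S x) n) atTop (𝓝 (min (S x) ⊤)) :=
      tendsto_const_nhds.min ENNReal.tendsto_nat_nhds_top
    rw [min_top_right] at h1
    refine h1.congr' ?_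
    obtain ⟨N, hN⟩ := exists_nat_gt ‖x‖
    filter_upwards [eventually_ge_atTop N] with n hn
    have : x ∈ ball (0 : E) n := by
      rw [mem_ball_zero_iff]
      exact hN.trans_le (by exact_mod_cast hn)
    simp [H, indicator_of_mem this]
  calc ∫⁻ x, S x ^ a ∂μ = ∫⁻ x, liminf (fun n => H n x ^ a) atTop ∂μ := by
        simp_rw [fun x => (hlim x).liminf_eq]
    _ ≤ liminf (fun n => ∫⁻ x, H n x ^ a ∂μ) atTop :=
        lintegral_liminf_le fun n => (hHm n).pow_const _
    _ ≤ _ := liminf_le_of_le (by isBoundedDefault) fun c hc => by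
        obtain ⟨n, hn⟩ := hc.exists
        exact hn.trans (hbound n)

/-- A bound on `L¹(w^{1-q})` for all `A₁` weights `w` yields `L^a` bounds for `1/q < a < 1`. -/
lemma exists_lintegral_rpow_le_of_lt_one {q a : ℝ} (hq : 1 < q) (ha : 1 < a * q) (ha1 : a < 1)
    {K : ℝ≥0∞ → ℝ≥0∞} (hK : ∀ A, A ≠ ∞ → K A ≠ ∞) :
    ∃ C : ℝ≥0∞, C ≠ ∞ ∧ ∀ S T : E → ℝ≥0∞, Measurable S → Measurable T →
      ∫⁻ x, T x ^ a ∂μ ≠ 0 → ∫⁻ x, T x ^ a ∂μ ≠ ∞ →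
      (∀ A, A ≠ ∞ → ∀ w : E → ℝ≥0∞, Measurable w → (∀ x, 0 < w x) →
        (∀ᵐ x ∂μ, w x < ∞) → (∀ x, centeredMax μ w x ≤ A * w x) →
        ∫⁻ x, S x * w x ^ (1 - q) ∂μ ≤ K A * ∫⁻ x, T x * w x ^ (1 - q) ∂μ) →
      ∫⁻ x, S x ^ a ∂μ ≤ C * ∫⁻ x, T x ^ a ∂μ := by
  have hq1 : 0 < q - 1 := by linarith
  have ha0 : 0 < a := pos_of_mul_pos_left (zero_lt_one.trans ha) (by linarith)
  have h1a : 0 < 1 - a := by linarith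
  set t := (1 - a) / (q - 1) with ht
  have ht0 : 0 < t := by positivity
  set r := a / t with hr
  have hr1 : 1 < r := by
    rw [hr, one_lt_div ht0, ht, div_lt_iff₀ hq1]
    linarith
  have htr : t * r = a := by rw [hr, mul_div_cancel₀ _ ht0.ne']
  obtain ⟨A, hA, hmaj⟩ := exists_A1_majorant μ hr1
  have := hK A hA
  refine ⟨K A ^ a * (2 ^ r) ^ (1 - a), by finiteness, fun S T hS hT h0 htop h => ?_⟩
  set Y := ∫⁻ x, T x ^ a ∂μ with hY
  obtain ⟨w, hw, hTw, hwA, hwr⟩ := hmaj (fun x => T x ^ t) (hT.pow_const _)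
  simp_rw [← ENNReal.rpow_mul, htr] at hwr
  rw [← hY] at hwr
  have hwfin : ∫⁻ x, w x ^ r ∂μ ≠ ∞ := ne_top_of_le_ne_top (by finiteness) hwr
  have hwtop : ∀ᵐ x ∂μ, w x < ∞ := by
    filter_upwards [ae_lt_top (hw.pow_const r) hwfin] with x hx
    exact (ENNReal.rpow_lt_top_iff_of_pos (by linarith)).1 hx
  have hwint : ∫⁻ x, w x ∂μ ≠ 0 := by
    intro hz
    apply h0
    rw [lintegral_eq_zero_iff hw] at hz
    rw [hY, lintegral_eq_zero_iff (hT.pow_const _)]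
    filter_upwards [hz] with x hx
    have h1 : T x ^ t ≤ 0 := (hTw x).trans_eq hx
    have h2 : T x = 0 := by simpa [ht0, ht0.not_gt] using h1
    simp [h2, ha0]
  have hw0 : ∀ x, 0 < w x := fun x => pos_iff_ne_zero.2 fun hz => by
    have := (centeredMax_pos μ hwint x).trans_le (hwA x)
    simp [hz] at this
  have hSw : ∫⁻ x, S x * w x ^ (1 - q) ∂μ ≤ K A * Y := by
    refine (h A hA w hw hw0 hwtop hwA).trans ?_
    refine mul_le_mul' le_rfl (lintegral_mono fun x => ?_)
    have h1 : w x ^ (1 - q) ≤ T x ^ (t * (1 - q)) := by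
      rw [ENNReal.rpow_mul, ← neg_sub q 1, ENNReal.rpow_neg, ENNReal.rpow_neg, ENNReal.inv_le_inv]
      exact ENNReal.rpow_le_rpow (hTw x) hq1.le
    have htq : t * (1 - q) = a - 1 := by
      rw [ht]
      field_simp
      ring
    rw [htq] at h1
    rcases eq_or_ne (T x) 0 with hT0 | hT0
    · simp [hT0]
    rcases eq_or_ne (T x) ∞ with hTt | hTt
    · simp [hTt, ha0]
    calc T x * w x ^ (1 - q) ≤ T x ^ (1 : ℝ) * T x ^ (a - 1) := by
          rw [ENNReal.rpow_one]
          gcongr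
      _ = T x ^ a := by rw [← ENNReal.rpow_add _ _ hT0 hTt, add_sub_cancel]
  have hconj : (1 / a).HolderConjugate (1 / (1 - a)) := by
    rw [Real.holderConjugate_iff]
    refine ⟨(one_lt_div ha0).2 ha1, ?_⟩
    simp
  calc ∫⁻ x, S x ^ a ∂μ
      = ∫⁻ x, (S x * w x ^ (1 - q)) ^ a * w x ^ ((q - 1) * a) ∂μ := by
        refine lintegral_congr_ae ?_
        filter_upwards [hwtop] with x hx
        rw [ENNReal.mul_rpow_of_nonneg _ _ ha0.le, mul_assoc, ← ENNReal.rpow_mul,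
          ← ENNReal.rpow_add _ _ (hw0 x).ne' hx.ne, ← add_mul]
        simp
    _ ≤ (∫⁻ x, ((S x * w x ^ (1 - q)) ^ a) ^ (1 / a) ∂μ) ^ (1 / (1 / a)) *
          (∫⁻ x, (w x ^ ((q - 1) * a)) ^ (1 / (1 - a)) ∂μ) ^ (1 / (1 / (1 - a))) :=
        ENNReal.lintegral_mul_le_Lp_mul_Lq μ hconj
          ((hS.mul (hw.pow_const _)).pow_const _).aemeasurable (hw.pow_const _).aemeasurable
    _ = (∫⁻ x, S x * w x ^ (1 - q) ∂μ) ^ a * (∫⁻ x, w x ^ r ∂μ) ^ (1 - a) := by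
        have hexp : (q - 1) * a * (1 / (1 - a)) = r := by
          rw [hr, ht]
          field_simp
        simp_rw [← ENNReal.rpow_mul, hexp, mul_one_div_cancel ha0.ne', ENNReal.rpow_one,
          one_div_one_div]
    _ ≤ (K A * Y) ^ a * (2 ^ r * Y) ^ (1 - a) := by gcongr
    _ = K A ^ a * (2 ^ r) ^ (1 - a) * (Y ^ a * Y ^ (1 - a)) := by
        rw [ENNReal.mul_rpow_of_nonneg _ _ ha0.le, ENNReal.mul_rpow_of_nonneg _ _ h1a.le]
        ring
    _ = _ := by rw [← ENNReal.rpow_add _ _ h0 htop, add_sub_cancel, ENNReal.rpow_one]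

/-- The Fefferman–Stein vector-valued maximal inequality, for the `q`-th powers of the vector
norms. -/
theorem exists_lintegral_tsum_centeredMax_rpow_le {ι : Type*} [Countable ι] {p q : ℝ} (hp : 1 < p)
    (hq : 1 < q) : ∃ C : ℝ≥0∞, C ≠ ∞ ∧ ∀ f : ι → E → ℝ≥0∞, (∀ j, Measurable (f j)) →
      ∫⁻ x, (∑' j, f j x ^ q) ^ (p / q) ∂μ ≠ ∞ →
      ∫⁻ x, (∑' j, centeredMax μ (f j) x ^ q) ^ (p / q) ∂μ ≤
        C * ∫⁻ x, (∑' j, f j x ^ q) ^ (p / q) ∂μ := by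
  have hq0 : 0 < q := by linarith
  have hSm : ∀ f : ι → E → ℝ≥0∞, Measurable fun x => ∑' j, centeredMax μ (f j) x ^ q := fun f =>
    Measurable.tsum fun j => (measurable_centeredMax μ _).pow_const _
  have hTm : ∀ f : ι → E → ℝ≥0∞, (∀ j, Measurable (f j)) →
      Measurable fun x => ∑' j, f j x ^ q := fun f hf =>
    Measurable.tsum fun j => (hf j).pow_const _
  -- a weighted inequality for scalar functions extends to sequences
  have hsum : ∀ {K : ℝ≥0∞} {u v : E → ℝ≥0∞}, Measurable u → Measurable v →
      (∀ g : E → ℝ≥0∞, Measurable g →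
        ∫⁻ x, centeredMax μ g x ^ q * u x ∂μ ≤ K * ∫⁻ x, g x ^ q * v x ∂μ) →
      ∀ f : ι → E → ℝ≥0∞, (∀ j, Measurable (f j)) →
        ∫⁻ x, (∑' j, centeredMax μ (f j) x ^ q) * u x ∂μ ≤
          K * ∫⁻ x, (∑' j, f j x ^ q) * v x ∂μ := by
    intro K u v hu hv h f hf
    simp_rw [← ENNReal.tsum_mul_right]
    have hfu : ∀ j, Measurable fun x => centeredMax μ (f j) x ^ q * u x := fun j =>
      ((measurable_centeredMax μ _).pow_const _).mul hu
    have hfv : ∀ j, Measurable fun x => f j x ^ q * v x := fun j => ((hf j).pow_const _).mul hv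
    rw [lintegral_tsum fun j => (hfu j).aemeasurable, lintegral_tsum fun j => (hfv j).aemeasurable,
      ← ENNReal.tsum_mul_left]
    exact ENNReal.tsum_le_tsum fun j => h _ (hf j)
  rcases lt_trichotomy p q with hpq | rfl | hpq
  · have hex : ∀ A : ℝ≥0∞, ∃ K : ℝ≥0∞, (A ≠ ∞ → K ≠ ∞) ∧ (A ≠ ∞ → ∀ w : E → ℝ≥0∞,
        Measurable w → (∀ x, 0 < w x) → (∀ᵐ x ∂μ, w x < ∞) →
        (∀ x, centeredMax μ w x ≤ A * w x) → ∀ g : E → ℝ≥0∞, Measurable g →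
        ∫⁻ x, centeredMax μ g x ^ q * w x ^ (1 - q) ∂μ ≤
          K * ∫⁻ x, g x ^ q * w x ^ (1 - q) ∂μ) := by
      intro A
      by_cases hA : A = ∞
      · exact ⟨0, fun h => (h hA).elim, fun h => (h hA).elim⟩
      · obtain ⟨K, hK, h⟩ := exists_lintegral_centeredMax_rpow_mul_rpow_le μ hq hA
        exact ⟨K, fun _ => hK, fun _ => h⟩
    choose K hK hKw using hex
    obtain ⟨C, hC, h⟩ := exists_lintegral_rpow_le_of_lt_one μ (a := p / q) hq
      (by rwa [div_mul_cancel₀ _ hq0.ne']) ((div_lt_one hq0).2 hpq) hK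
    refine ⟨C, hC, fun f hf htop => ?_⟩
    by_cases h0 : ∫⁻ x, (∑' j, f j x ^ q) ^ (p / q) ∂μ = 0
    · rw [h0, mul_zero, le_zero_iff]
      rw [lintegral_eq_zero_iff ((hTm f hf).pow_const _)] at h0
      have hpq0 : 0 < p / q := by positivity
      have hzero : ∀ j, f j =ᵐ[μ] 0 := fun j => by
        filter_upwards [h0] with x hx
        have h1 : ∀ j, f j x ^ q = 0 := by
          simpa [ENNReal.rpow_eq_zero_iff, hpq0, hpq0.not_gt] using hx
        simpa [hq0, hq0.not_gt] using h1 j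
      simp [fun j => centeredMax_eq_zero_of_ae_eq_zero (hzero j), hq0, hpq0]
    · exact h _ _ (hSm f) (hTm f hf) h0 htop fun A hA w hw hw0 hwtop hwA =>
        hsum (hw.pow_const _) (hw.pow_const _) (hKw A hA w hw hw0 hwtop hwA) f hf
  · obtain ⟨K, hK, h⟩ := exists_lintegral_centeredMax_rpow_le E hp
    refine ⟨K, hK, fun f hf _ => ?_⟩
    simp only [div_self hq0.ne', ENNReal.rpow_one]
    simpa using hsum (u := 1) (v := 1) measurable_one measurable_one
      (fun g hg => by simpa using h μ g hg) f hf
  · obtain ⟨K, hK, h⟩ := exists_lintegral_centeredMax_rpow_mul_le μ hq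
    obtain ⟨C, hC, h'⟩ := exists_lintegral_rpow_le_of_one_lt μ ((one_lt_div hq0).2 hpq) hK
    exact ⟨C, hC, fun f hf _ => h' _ _ (hSm f) (hTm f hf) fun w hw =>
      hsum hw (measurable_centeredMax μ w) (h w hw) f hf⟩

end VectorValued

end Maximal

theorem fefferman_stein (d : ℕ) (hd : 1 ≤ d) (p q : ℝ) (hp : 1 < p) (hq : 1 < q) :
    ∃ C : ℝ, 0 < C ∧ ∀ f : ℤ → EuclideanSpace ℝ (Fin d) → ℂ,
      (∀ j, Measurable (f j)) →
      (∫⁻ x, ((∑' j : ℤ, maxFn (f j) x ^ q) ^ (1 / q)) ^ p) ^ (1 / p) ≤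
        ENNReal.ofReal C *
          (∫⁻ x, ((∑' j : ℤ, ((‖f j x‖₊ : ℝ≥0∞)) ^ q) ^ (1 / q)) ^ p) ^ (1 / p) := by
  have hp0 : 0 < p := by linarith
  obtain ⟨K, hK, h⟩ := exists_lintegral_tsum_centeredMax_rpow_le
    (volume : Measure (EuclideanSpace ℝ (Fin d))) (ι := ℤ) hp hq
  have hKp : K ^ (1 / p) ≠ ∞ := by finiteness
  have hC : 0 < (K ^ (1 / p)).toReal + 1 := by positivity
  refine ⟨(K ^ (1 / p)).toReal + 1, hC, fun f hf => ?_⟩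
  simp_rw [← ENNReal.rpow_mul, one_div_mul_eq_div]
  by_cases htop : ∫⁻ x, (∑' j : ℤ, ((‖f j x‖₊ : ℝ≥0∞)) ^ q) ^ (p / q) = ∞
  · rw [htop, ENNReal.top_rpow_of_pos (by positivity), ENNReal.mul_top (by simpa using hC)]
    exact le_top
  calc (∫⁻ x, (∑' j : ℤ, maxFn (f j) x ^ q) ^ (p / q)) ^ (1 / p)
      ≤ (K * ∫⁻ x, (∑' j : ℤ, ((‖f j x‖₊ : ℝ≥0∞)) ^ q) ^ (p / q)) ^ (1 / p) := by
        gcongr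
        exact h (fun j x => ‖f j x‖₊) (fun j => (hf j).nnnorm.coe_nnreal_ennreal) htop
    _ = K ^ (1 / p) * (∫⁻ x, (∑' j : ℤ, ((‖f j x‖₊ : ℝ≥0∞)) ^ q) ^ (p / q)) ^ (1 / p) :=
        ENNReal.mul_rpow_of_nonneg _ _ (by positivity)
    _ ≤ _ := by
        gcongr
        rw [ENNReal.le_ofReal_iff_toReal_le hKp hC.le]
        linarith
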